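/- arXiv:2412.01344 — 2 statements merged into one kernel-verified Lean document; each statement's English description precedes it below -/
import Mathlib

section
/- Let E be a real Hilbert space and f : E → ℝ differentiable with L-Lipschitz gradient, where L > 0. Assume |f(x)| ≤ B and ‖∇f(x)‖ ≤ G_V for all x ∈ E, with B, G_V, G_E ≥ 0. Let 0 < η < 2/L, and let sequences (θ_t)_{t≥1} in E and (g_t)_{t≥1} in E satisfy θ_{t+1} = θ_t + η • g_t and ‖g_t − ∇f(θ_t)‖ ≤ G_E for all t ≥ 1. Then for every natural number T ≥ 1, min_{1 ≤ t ≤ T} ‖∇f(θ_t)‖² ≤ ( (2/T)·B + |Lη² − η|·G_V·G_E + (Lη²/2)·G_E² ) / (η − Lη²/2). -/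
open scoped InnerProductSpace

section Ascent

variable {E : Type*} [NormedAddCommGroup E] [InnerProductSpace ℝ E] [CompleteSpace E]

/-- Quadratic lower bound for a function with `L`-Lipschitz gradient. -/
theorem quadratic_lower_bound_of_lipschitz_gradient {f : E → ℝ} (hf : Differentiable ℝ f) {L : ℝ}
    (hLip : ∀ x y : E, ‖gradient f x - gradient f y‖ ≤ L * ‖x - y‖) (x v : E) :
    f x + ⟪gradient f x, v⟫_ℝ - L / 2 * ‖v‖ ^ 2 ≤ f (x + v) := by
  set h : ℝ → ℝ := fun s => f (x + s • v) - s * ⟪gradient f x, v⟫_ℝ + L / 2 * ‖v‖ ^ 2 * s ^ 2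
  have hderiv (s : ℝ) : HasDerivAt h
      (⟪gradient f (x + s • v) - gradient f x, v⟫_ℝ + L * s * ‖v‖ ^ 2) s := by
    have hline : HasDerivAt (fun s : ℝ => x + s • v) v s := by
      simpa using ((hasDerivAt_id s).smul_const v).const_add x
    have hcomp := (hf (x + s • v)).hasGradientAt.hasFDerivAt.comp_hasDerivAt s hline
    have hlin := (hasDerivAt_id s).mul_const ⟪gradient f x, v⟫_ℝ
    have hquad := (hasDerivAt_pow 2 s).const_mul (L / 2 * ‖v‖ ^ 2)
    refine ((hcomp.sub hlin).add hquad).congr_deriv ?_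
    simp only [InnerProductSpace.toDual_apply_apply, inner_sub_left]
    norm_num
    ring
  have hmono : MonotoneOn h (Set.Icc 0 1) := by
    refine monotoneOn_of_deriv_nonneg (convex_Icc 0 1)
      (fun s _ => (hderiv s).continuousAt.continuousWithinAt)
      (fun s _ => (hderiv s).differentiableAt.differentiableWithinAt) fun s hs => ?_
    rw [interior_Icc] at hs
    rw [(hderiv s).deriv]
    have hinner := (abs_le.mp (abs_real_inner_le_norm
      (gradient f (x + s • v) - gradient f x) v)).1
    have hgrad := hLip (x + s • v) x
    rw [add_sub_cancel_left, norm_smul, Real.norm_of_nonneg hs.1.le] at hgrad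
    nlinarith [mul_le_mul_of_nonneg_right hgrad (norm_nonneg v)]
  have h01 : h 0 ≤ h 1 := hmono (by simp) (by simp) zero_le_one
  simp only [h, zero_smul, one_smul, add_zero] at h01
  linarith

/-- One step of gradient ascent with an inexact gradient `g` increases the objective by at least
a multiple of the squared gradient norm, up to an error controlled by the bias of `g`. -/
theorem inexact_gradient_step_lower_bound {f : E → ℝ} (hf : Differentiable ℝ f) {L : ℝ}
    (hL : 0 ≤ L) (hLip : ∀ x y : E, ‖gradient f x - gradient f y‖ ≤ L * ‖x - y‖)
    {G ε : ℝ} {x g : E} (hG : ‖gradient f x‖ ≤ G) (hg : ‖g - gradient f x‖ ≤ ε) (η : ℝ) :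
    (η - L * η ^ 2 / 2) * ‖gradient f x‖ ^ 2
      - (|L * η ^ 2 - η| * G * ε + L * η ^ 2 / 2 * ε ^ 2) ≤ f (x + η • g) - f x := by
  have hquad := quadratic_lower_bound_of_lipschitz_gradient hf hLip x (η • g)
  obtain ⟨e, rfl⟩ : ∃ e, g = gradient f x + e := ⟨g - gradient f x, by abel⟩
  rw [add_sub_cancel_left] at hg
  rw [inner_smul_right, inner_add_right, real_inner_self_eq_norm_sq, norm_smul, mul_pow,
    norm_add_sq_real, Real.norm_eq_abs, sq_abs] at hquad
  have hcross : (L * η ^ 2 - η) * ⟪gradient f x, e⟫_ℝ ≤ |L * η ^ 2 - η| * G * ε := by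
    refine (le_abs_self _).trans ?_
    rw [abs_mul, mul_assoc]
    gcongr
    exact (abs_real_inner_le_norm _ _).trans
      (mul_le_mul hG hg (norm_nonneg _) ((norm_nonneg _).trans hG))
  have hsq : L * η ^ 2 / 2 * ‖e‖ ^ 2 ≤ L * η ^ 2 / 2 * ε ^ 2 := by gcongr
  linarith

end Ascent


theorem stmt_11 {E : Type*} [NormedAddCommGroup E] [InnerProductSpace ℝ E] [CompleteSpace E]
    (f : E → ℝ) (hf : Differentiable ℝ f) (L : ℝ) (hLpos : 0 < L)
    (hLip : ∀ x y : E, ‖gradient f x - gradient f y‖ ≤ L * ‖x - y‖)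
    (B G_V G_E : ℝ) (hB : 0 ≤ B) (hGV : 0 ≤ G_V) (hGE : 0 ≤ G_E)
    (hfB : ∀ x : E, |f x| ≤ B) (hfG : ∀ x : E, ‖gradient f x‖ ≤ G_V)
    (η : ℝ) (hη0 : 0 < η) (hη2 : η < 2 / L)
    (θ g : ℕ → E)
    (hstep : ∀ t : ℕ, 1 ≤ t → θ (t + 1) = θ t + η • g t)
    (herr : ∀ t : ℕ, 1 ≤ t → ‖g t - gradient f (θ t)‖ ≤ G_E)
    (T : ℕ) (hT : 1 ≤ T) :
    ∃ t : ℕ, 1 ≤ t ∧ t ≤ T ∧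
      ‖gradient f (θ t)‖ ^ 2 ≤
        ((2 / (T : ℝ)) * B + |L * η ^ 2 - η| * G_V * G_E + (L * η ^ 2 / 2) * G_E ^ 2) /
          (η - L * η ^ 2 / 2) := by
  have hden : 0 < η - L * η ^ 2 / 2 := by
    rw [lt_div_iff₀ hLpos] at hη2
    nlinarith
  have hT' : (0 : ℝ) < T := by exact_mod_cast hT
  by_contra! hlarge
  have hincr : ∀ i ∈ Finset.range T, 2 / (T : ℝ) * B < f (θ (i + 1 + 1)) - f (θ (i + 1)) := by
    intro i hi
    have hstep_bound := inexact_gradient_step_lower_bound hf hLpos.le hLip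
      (hfG (θ (i + 1))) (herr (i + 1) (by omega)) η
    have hlt := hlarge (i + 1) (by omega) (Finset.mem_range.mp hi)
    rw [div_lt_iff₀ hden] at hlt
    rw [hstep (i + 1) (by omega)]
    linarith
  have hsum := Finset.sum_lt_sum_of_nonempty (Finset.nonempty_range_iff.mpr (by omega)) hincr
  rw [Finset.sum_range_sub (fun i => f (θ (i + 1))), Finset.sum_const, Finset.card_range,
    nsmul_eq_mul, ← mul_assoc, mul_div_cancel₀ _ hT'.ne'] at hsum
  have hupper := (abs_le.mp (hfB (θ (T + 1)))).2
  have hlower := (abs_le.mp (hfB (θ (0 + 1)))).1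
  linarith
end

section
/- Let k ≥ 1 and let a : Fin k → ℝ be strictly increasing with 0 < a i < 1 for all i (the knots). Let π : ℝ → ℝ be piecewise constant with respect to these knots, meaning: for all x, y ∈ [0,1], if x and y lie in the same piece (where the pieces are I_0 = [0, a_0), I_j = [a_j, a_{j+1}) for 0 ≤ j < k−1, and I_{k−1} = [a_{k−1}, 1]) then π x = π y. Let c > 0 and define the utility U(u₀, u) = π u − c·|u − u₀|. Then for every u₀ ∈ [0,1] and every u' ∈ [0,1] with u' ≠ u₀ and u' not equal to any knot a i, there exists u'' ∈ [0,1] with U(u₀, u'') > U(u₀, u'); in particular, u' is not a maximizer of U(u₀, ·) over [0,1]. -/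
/-- Two points of `[0,1]` lie in the same piece of the partition induced by the knots
`a : Fin k → ℝ` (pieces `[0, a 0)`, `[a 0, a 1)`, …, `[a (k-1), 1]`, each left-closed at
its knot) iff exactly the same knots lie (weakly) below them. -/
def SamePiece {k : ℕ} (a : Fin k → ℝ) (x y : ℝ) : Prop :=
  ∀ i : Fin k, a i ≤ x ↔ a i ≤ y

open Filter Topology in
/-- Away from the knots, all nearby points lie in the same piece. -/
theorem eventually_samePiece {k : ℕ} {a : Fin k → ℝ} {x : ℝ} (hx : ∀ i, x ≠ a i) :
    ∀ᶠ y in 𝓝 x, SamePiece a x y := by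
  refine eventually_all.2 fun i => ?_
  rcases lt_or_gt_of_ne (hx i) with h | h
  · filter_upwards [eventually_lt_nhds h] with y hy
    exact iff_of_false h.not_ge hy.not_ge
  · filter_upwards [eventually_gt_nhds h] with y hy
    exact iff_of_true h.le hy.le

open Filter Topology in
theorem stmt_12 (k : ℕ) (hk : 1 ≤ k) (a : Fin k → ℝ) (ha : StrictMono a)
    (ha0 : ∀ i : Fin k, 0 < a i) (ha1 : ∀ i : Fin k, a i < 1)
    (π : ℝ → ℝ)
    (hπ : ∀ x ∈ Set.Icc (0 : ℝ) 1, ∀ y ∈ Set.Icc (0 : ℝ) 1,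
      SamePiece a x y → π x = π y)
    (c : ℝ) (hc : 0 < c) :
    ∀ u₀ ∈ Set.Icc (0 : ℝ) 1, ∀ u' ∈ Set.Icc (0 : ℝ) 1,
      u' ≠ u₀ → (∀ i : Fin k, u' ≠ a i) →
        ∃ u'' ∈ Set.Icc (0 : ℝ) 1,
          π u'' - c * |u'' - u₀| > π u' - c * |u' - u₀| := by
  intro u₀ h₀ u' h' hne hknot
  have hlim : Tendsto (AffineMap.lineMap u' u₀ : ℝ → ℝ) (𝓝[>] 0) (𝓝 u') := by
    have h := (AffineMap.lineMap_continuous (R := ℝ) (p := u') (q := u₀)).tendsto 0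
    rw [AffineMap.lineMap_apply_zero] at h
    exact h.mono_left nhdsWithin_le_nhds
  obtain ⟨t, hs, ht0, ht1⟩ := ((hlim.eventually (eventually_samePiece hknot)).and
    (Ioo_mem_nhdsGT (zero_lt_one' ℝ))).exists
  have hmem := (convex_Icc (0 : ℝ) 1).lineMap_mem h' h₀ ⟨ht0.le, ht1.le⟩
  refine ⟨_, hmem, ?_⟩
  have hdist : |AffineMap.lineMap u' u₀ t - u₀| = (1 - t) * |u' - u₀| := by
    rw [← abs_of_pos (sub_pos.2 ht1), ← abs_mul, AffineMap.lineMap_apply_ring']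
    ring_nf
  rw [← hπ _ h' _ hmem hs, hdist]
  have hpos : 0 < c * (t * |u' - u₀|) :=
    mul_pos hc (mul_pos ht0 (abs_pos.2 (sub_ne_zero.2 hne)))
  linarith
end
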